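/- For every K > 0 there exists a positive constant C₀, depending only on K, with the following property: for every 1-periodic C² function F : ℝ³ → ℝ with sup|F| ≤ K and ∫_{[0,1]³} e^F dV = 1, and every u ∈ C̃²(T³) solving the reduced Calabi–Yau equation (u_xx + 1)(u_yy + u_tt + u_t + 1) − u_xy² − u_xt² = e^F, one has sup_{ℝ³} |u| ≤ C₀. -/

import Mathlib

open MeasureTheory

noncomputable section

/-- Points of `ℝ³`, written as `ℝ × ℝ × ℝ`. -/
abbrev R3 := ℝ × ℝ × ℝ

/-- The coordinate direction `x`. -/
def vx : R3 := (1, 0, 0)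
/-- The coordinate direction `y`. -/
def vy : R3 := (0, 1, 0)
/-- The coordinate direction `t`. -/
def vt : R3 := (0, 0, 1)

/-- Partial (directional) derivative in the direction `e`. -/
def pd (e : R3) (u : R3 → ℝ) : R3 → ℝ := fun p => fderiv ℝ u p e

/-- `1`-periodicity in each of the three variables. -/
def Periodic3 (u : R3 → ℝ) : Prop :=
  ∀ p : R3, u (p + vx) = u p ∧ u (p + vy) = u p ∧ u (p + vt) = u p

/-- The unit cube `[0,1]³`. -/
def cube : Set R3 := Set.Icc (0, 0, 0) (1, 1, 1)

/-- Zero mean over the unit cube. -/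
def ZeroMean (u : R3 → ℝ) : Prop := ∫ p in cube, u p = 0

/-- The reduced Calabi–Yau equation
`(u_xx + 1)(u_yy + u_tt + u_t + 1) − u_xy² − u_xt² = e^F` on `ℝ³`. -/
def CYeq (F u : R3 → ℝ) : Prop :=
  ∀ p : R3,
    (pd vx (pd vx u) p + 1)
        * (pd vy (pd vy u) p + pd vt (pd vt u) p + pd vt u p + 1)
      - (pd vy (pd vx u) p) ^ 2 - (pd vt (pd vx u) p) ^ 2 = Real.exp (F p)

/-- The Euclidean norm on `ℝ³ = ℝ × ℝ × ℝ`. -/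
def enorm3 (h : R3) : ℝ := Real.sqrt (h.1 ^ 2 + h.2.1 ^ 2 + h.2.2 ^ 2)

section Lemmas

open Set Filter Topology

lemma cube_eq_prod : cube = Icc (0 : ℝ) 1 ×ˢ (Icc (0 : ℝ) 1 ×ˢ Icc (0 : ℝ) 1) := by
  ext ⟨x, y, t⟩
  simp only [cube, mem_Icc, mem_prod, Prod.mk_le_mk]
  tauto

lemma isCompact_cube : IsCompact cube := isCompact_Icc

lemma integrableOn_cube {f : R3 → ℝ} (hf : Continuous f) : IntegrableOn f cube :=
  hf.continuousOn.integrableOn_compact isCompact_cube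

lemma integral_cube_eq_iterated {f : R3 → ℝ} (hf : Continuous f) :
    ∫ p in cube, f p =
      ∫ x in (0 : ℝ)..1, ∫ y in (0 : ℝ)..1, ∫ t in (0 : ℝ)..1, f (x, y, t) := by
  have h1 : IntegrableOn f (Icc (0 : ℝ) 1 ×ˢ (Icc (0 : ℝ) 1 ×ˢ Icc (0 : ℝ) 1))
      (volume.prod volume) := by
    rw [← cube_eq_prod]; exact integrableOn_cube hf
  rw [cube_eq_prod, Measure.volume_eq_prod, setIntegral_prod _ h1,
    intervalIntegral.integral_of_le zero_le_one, integral_Icc_eq_integral_Ioc]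
  refine integral_congr_ae (Eventually.of_forall fun x => ?_)
  have h2 : IntegrableOn (fun q : ℝ × ℝ => f (x, q)) (Icc (0 : ℝ) 1 ×ˢ Icc (0 : ℝ) 1)
      (volume.prod volume) :=
    (hf.comp (by fun_prop)).continuousOn.integrableOn_compact (isCompact_Icc.prod isCompact_Icc)
  simp only [Measure.volume_eq_prod]
  rw [setIntegral_prod _ h2,
    intervalIntegral.integral_of_le zero_le_one, integral_Icc_eq_integral_Ioc]
  refine integral_congr_ae (Eventually.of_forall fun y => ?_)
  simp only
  rw [intervalIntegral.integral_of_le zero_le_one, integral_Icc_eq_integral_Ioc]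

lemma integral_cube_eq_fiber {f : R3 → ℝ} (hf : Continuous f) :
    ∫ p in cube, f p =
      ∫ q in Ioc (0 : ℝ) 1 ×ˢ Ioc (0 : ℝ) 1, ∫ x in (0 : ℝ)..1, f (x, q) := by
  have h1 : IntegrableOn f (Icc (0 : ℝ) 1 ×ˢ (Icc (0 : ℝ) 1 ×ˢ Icc (0 : ℝ) 1))
      (volume.prod (volume.prod volume)) := by
    rw [← cube_eq_prod]; exact integrableOn_cube hf
  have h2 : (volume : Measure ℝ).restrict (Icc 0 1) = volume.restrict (Ioc 0 1) :=
    (Measure.restrict_congr_set Ioc_ae_eq_Icc).symm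
  rw [IntegrableOn, ← Measure.prod_restrict, ← Measure.prod_restrict, h2] at h1
  rw [cube_eq_prod, Measure.volume_eq_prod ℝ (ℝ × ℝ), Measure.volume_eq_prod ℝ ℝ,
    ← Measure.prod_restrict, ← Measure.prod_restrict, ← Measure.prod_restrict, h2,
    integral_prod_symm _ h1]
  simp only [intervalIntegral.integral_of_le zero_le_one]

lemma Periodic3.add_vx {f : R3 → ℝ} (hf : Periodic3 f) (x y t : ℝ) :
    f (x + 1, y, t) = f (x, y, t) := by
  simpa [vx] using (hf (x, y, t)).1

lemma Periodic3.add_vy {f : R3 → ℝ} (hf : Periodic3 f) (x y t : ℝ) :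
    f (x, y + 1, t) = f (x, y, t) := by
  simpa [vy] using (hf (x, y, t)).2.1

lemma Periodic3.add_vt {f : R3 → ℝ} (hf : Periodic3 f) (x y t : ℝ) :
    f (x, y, t + 1) = f (x, y, t) := by
  simpa [vt] using (hf (x, y, t)).2.2

lemma Function.Periodic.intervalIntegral_comp_add_right {g : ℝ → ℝ} (hg : Function.Periodic g 1)
    (h : ℝ) : ∫ x in (0 : ℝ)..1, g (x + h) = ∫ x in (0 : ℝ)..1, g x := by
  rw [intervalIntegral.integral_comp_add_right]
  have := hg.intervalIntegral_add_eq h 0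
  simpa [add_comm] using this

/-- The integral of a periodic function over the unit cube is translation invariant. -/
lemma integral_cube_comp_add {f : R3 → ℝ} (hf : Continuous f) (hp : Periodic3 f) (a : R3) :
    ∫ p in cube, f (p + a) = ∫ p in cube, f p := by
  obtain ⟨a, b, c⟩ := a
  rw [integral_cube_eq_iterated hf, integral_cube_eq_iterated (by fun_prop)]
  simp only [Prod.mk_add_mk]
  have h1 : ∀ x y, ∫ t in (0 : ℝ)..1, f (x, y, t + c) = ∫ t in (0 : ℝ)..1, f (x, y, t) :=
    fun x y => Function.Periodic.intervalIntegral_comp_add_right (g := fun t => f (x, y, t))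
      (fun t => hp.add_vt x y t) c
  have h2 : ∀ x, ∫ y in (0 : ℝ)..1, ∫ t in (0 : ℝ)..1, f (x, y + b, t) =
      ∫ y in (0 : ℝ)..1, ∫ t in (0 : ℝ)..1, f (x, y, t) :=
    fun x => Function.Periodic.intervalIntegral_comp_add_right
      (g := fun y => ∫ t in (0 : ℝ)..1, f (x, y, t)) (fun y => by simp only [hp.add_vy]) b
  simp only [h1, h2]
  exact Function.Periodic.intervalIntegral_comp_add_right
      (g := fun x => ∫ y in (0 : ℝ)..1, ∫ t in (0 : ℝ)..1, f (x, y, t))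
      (fun x => by simp only [hp.add_vx]) a

lemma Periodic3.pd {f : R3 → ℝ} (hf : Periodic3 f) (e : R3) : Periodic3 (pd e f) := by
  have h : ∀ v : R3, (∀ p, f (p + v) = f p) → ∀ p, _root_.pd e f (p + v) = _root_.pd e f p := by
    intro v hv p
    have := fderiv_comp_add_right (𝕜 := ℝ) (f := f) (x := p) v
    simp only [hv] at this
    simp only [_root_.pd, ← this]
  exact fun p => ⟨h _ (fun q => (hf q).1) p, h _ (fun q => (hf q).2.1) p,
    h _ (fun q => (hf q).2.2) p⟩

lemma Periodic3.mul {f g : R3 → ℝ} (hf : Periodic3 f) (hg : Periodic3 g) :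
    Periodic3 (fun p => f p * g p) := fun p => by
  simp only [hf p, hg p, and_self]

lemma ContDiff.pd {f : R3 → ℝ} {m n : WithTop ℕ∞} (hf : ContDiff ℝ n f) (hmn : m + 1 ≤ n)
    (e : R3) : ContDiff ℝ m (pd e f) :=
  (hf.fderiv_right hmn).clm_apply contDiff_const

lemma pd_mul {f g : R3 → ℝ} (hf : ContDiff ℝ 1 f) (hg : ContDiff ℝ 1 g) (e p : R3) :
    pd e (fun q => f q * g q) p = pd e f p * g p + f p * pd e g p := by
  have hf' := (hf.differentiable one_ne_zero) p
  have hg' := (hg.differentiable one_ne_zero) p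
  simp only [pd]
  rw [fderiv_fun_mul hf' hg']
  simp
  ring

lemma pd_comm {f : R3 → ℝ} (hf : ContDiff ℝ 2 f) (v w : R3) :
    pd v (pd w f) = pd w (pd v f) := by
  funext p
  have hd : DifferentiableAt ℝ (fderiv ℝ f) p :=
    ((hf.fderiv_right (m := 1) (by norm_num)).differentiable one_ne_zero) p
  have hs : IsSymmSndFDerivAt ℝ f p := hf.contDiffAt.isSymmSndFDerivAt (by simp)
  have h : ∀ v w, pd v (pd w f) p = fderiv ℝ (fderiv ℝ f) p v w := by
    intro v w
    change fderiv ℝ (fun q => fderiv ℝ f q w) p v = _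
    rw [fderiv_clm_apply hd (differentiableAt_const w)]
    simp
  rw [h, h, hs.eq]

lemma hasDerivAt_comp_add_smul {f : R3 → ℝ} (hf : ContDiff ℝ 1 f) (p e : R3) (h : ℝ) :
    HasDerivAt (fun s : ℝ => f (p + s • e)) (pd e f (p + h • e)) h := by
  have h1 : HasDerivAt (fun s : ℝ => p + s • e) e h := by
    simpa using ((hasDerivAt_id h).smul_const e).const_add p
  exact ((hf.differentiable one_ne_zero) (p + h • e)).hasFDerivAt.comp_hasDerivAt h h1

/-- Differentiation of a correlation integral in the shift variable. -/
lemma hasDerivAt_integral_mul_shift {a b : R3 → ℝ} (ha : Continuous a) (hb : ContDiff ℝ 1 b)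
    (e : R3) :
    HasDerivAt (fun h : ℝ => ∫ p in cube, a p * b (p + h • e))
      (∫ p in cube, a p * pd e b p) 0 := by
  have hb0 : Continuous b := hb.continuous
  have hb1 : Continuous (pd e b) := (hb.pd (m := 0) (by norm_num) e).continuous
  obtain ⟨M, hM⟩ := (isCompact_cube.prod (isCompact_Icc (a := (-1 : ℝ)) (b := 1))).exists_bound_of_continuousOn
    (f := fun z : R3 × ℝ => a z.1 * pd e b (z.1 + z.2 • e)) (by fun_prop)
  have key := hasDerivAt_integral_of_dominated_loc_of_deriv_le
    (μ := volume.restrict cube) (x₀ := (0 : ℝ)) (s := Ioo (-1) 1)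
    (F := fun h p => a p * b (p + h • e)) (F' := fun h p => a p * pd e b (p + h • e))
    (bound := fun _ => M) (Ioo_mem_nhds (by norm_num) (by norm_num))
    (Eventually.of_forall fun h => Continuous.aestronglyMeasurable (by fun_prop))
    (integrableOn_cube (by fun_prop))
    (Continuous.aestronglyMeasurable (by fun_prop))
    (by
      refine (ae_restrict_iff' isCompact_cube.measurableSet).2 (Eventually.of_forall ?_)
      intro p hp h hh
      exact hM (p, h) ⟨hp, Ioo_subset_Icc_self hh⟩)
    (integrableOn_cube continuous_const)
    (Eventually.of_forall fun p h _ => (hasDerivAt_comp_add_smul hb p e h).const_mul (a p))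
  simpa using key.2

lemma integral_pd_eq_zero {f : R3 → ℝ} (hf : ContDiff ℝ 1 f) (hp : Periodic3 f) (e : R3) :
    ∫ p in cube, pd e f p = 0 := by
  have h1 := hasDerivAt_integral_mul_shift (a := fun _ => 1) continuous_const hf e
  simp only [one_mul, integral_cube_comp_add hf.continuous hp] at h1
  exact h1.unique (hasDerivAt_const _ _)

lemma integral_mul_pd {f g : R3 → ℝ} (hf : ContDiff ℝ 1 f) (hg : ContDiff ℝ 1 g)
    (pf : Periodic3 f) (pg : Periodic3 g) (e : R3) :
    ∫ p in cube, f p * pd e g p = -∫ p in cube, pd e f p * g p := by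
  have h := integral_pd_eq_zero (hf.mul hg) (pf.mul pg) e
  have c1 : Continuous (pd e f) := (hf.pd (m := 0) (by norm_num) e).continuous
  have c2 : Continuous (pd e g) := (hg.pd (m := 0) (by norm_num) e).continuous
  have c3 := hf.continuous
  have c4 := hg.continuous
  simp only [pd_mul hf hg] at h
  rw [integral_add (integrableOn_cube (by fun_prop)) (integrableOn_cube (by fun_prop))] at h
  linarith

/-- The Jacobian determinant of a pair of periodic `C¹` functions has zero mean. -/
lemma integral_pd_mul_pd_comm {f g : R3 → ℝ} (hf : ContDiff ℝ 1 f) (hg : ContDiff ℝ 1 g)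
    (pf : Periodic3 f) (pg : Periodic3 g) (v w : R3) :
    ∫ p in cube, pd v f p * pd w g p = ∫ p in cube, pd w f p * pd v g p := by
  have c1 : Continuous (pd v f) := (hf.pd (m := 0) (by norm_num) v).continuous
  have c2 : Continuous (pd v g) := (hg.pd (m := 0) (by norm_num) v).continuous
  have c3 := hf.continuous
  have h1 := hasDerivAt_integral_mul_shift c1 hg w
  have h2 := hasDerivAt_integral_mul_shift c2 hf (-w)
  have h3 : ∀ h : ℝ, ∫ p in cube, pd v f p * g (p + h • w)
      = -∫ p in cube, pd v g p * f (p + h • (-w)) := by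
    intro h
    have hs : ContDiff ℝ 1 (fun p => g (p + h • w)) := hg.comp (by fun_prop)
    have ps : ∀ {f : R3 → ℝ}, Periodic3 f → Periodic3 (fun p => f (p + h • w)) := by
      intro f pf p
      have := pf (p + h • w)
      simpa only [add_right_comm] using this
    have e1 : ∀ p, pd v (fun p => g (p + h • w)) p = pd v g (p + h • w) := by
      intro p; simp only [pd]; rw [fderiv_comp_add_right]
    have h4 := integral_mul_pd hf hs pf (ps pg) v
    simp only [e1] at h4
    have pq : Periodic3 (fun p => f (p + h • (-w)) * pd v g p) := by
      refine Periodic3.mul ?_ (pg.pd v)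
      intro p
      have := pf (p + h • (-w))
      simpa only [add_right_comm] using this
    have h5 := integral_cube_comp_add (f := fun p => f (p + h • (-w)) * pd v g p)
      (by fun_prop) pq (h • w)
    have e2 : ∀ p : R3, p + h • w + h • (-w) = p := by intro p; simp
    simp only [e2] at h5
    rw [h4] at h5
    rw [← neg_eq_iff_eq_neg, h5]
    simp only [mul_comm]
  simp only [h3] at h1
  have h6 := h1.unique h2.neg
  have e3 : ∀ p, pd (-w) f p = - pd w f p := by intro p; simp [pd]
  rw [h6]
  simp only [e3, mul_neg, integral_neg, neg_neg, mul_comm]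

lemma integral_mul_pd_pd {f g : R3 → ℝ} (hf : ContDiff ℝ 2 f) (hg : ContDiff ℝ 2 g)
    (pf : Periodic3 f) (pg : Periodic3 g) (e : R3) :
    ∫ p in cube, f p * pd e (pd e g) p = ∫ p in cube, g p * pd e (pd e f) p := by
  have f1 : ContDiff ℝ 1 (pd e f) := hf.pd (by norm_num) e
  have g1 : ContDiff ℝ 1 (pd e g) := hg.pd (by norm_num) e
  have hf' : ContDiff ℝ 1 f := hf.of_le (by norm_num)
  have hg' : ContDiff ℝ 1 g := hg.of_le (by norm_num)
  rw [integral_mul_pd hf' g1 pf (pg.pd e), integral_mul_pd hg' f1 pg (pf.pd e)]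
  simp only [mul_comm]

lemma integral_pd_pd_mul_pd_mul {u ψ : R3 → ℝ} (hu : ContDiff ℝ 2 u) (pu : Periodic3 u)
    (hψ : ContDiff ℝ 1 ψ) (pψ : Periodic3 ψ) {v : R3} (hv : ∀ p, pd v ψ p = 0) (e : R3) :
    ∫ p in cube, pd v (pd v u) p * (pd e u p * ψ p)
      = 1 / 2 * ∫ p in cube, pd v u p ^ 2 * pd e ψ p := by
  have u1 : ∀ w, ContDiff ℝ 1 (pd w u) := fun w => hu.pd (by norm_num) w
  have h1 := integral_mul_pd ((u1 e).mul hψ) (u1 v) ((pu.pd e).mul pψ) (pu.pd v) v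
  simp only [pd_mul (u1 e) hψ, hv, mul_zero, add_zero, pd_comm hu v e] at h1
  have h2 := integral_mul_pd ((u1 v).mul (u1 v)) hψ ((pu.pd v).mul (pu.pd v)) pψ e
  simp only [pd_mul (u1 v) (u1 v)] at h2
  have h3 : ∀ p, (pd e (pd v u) p * pd v u p + pd v u p * pd e (pd v u) p) * ψ p
      = 2 * (pd e (pd v u) p * ψ p * pd v u p) := fun p => by ring
  simp only [h3, integral_const_mul] at h2
  simp only [pow_two, mul_comm (pd v (pd v u) _)]
  rw [h1, h2]
  ring

lemma integral_hessian_minor_mul {u φ : R3 → ℝ} (hu : ContDiff ℝ 2 u) (pu : Periodic3 u)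
    (hφ : ContDiff ℝ 2 φ) (pφ : Periodic3 φ) {v : R3} (hv : ∀ p, pd v φ p = 0) (e : R3) :
    ∫ p in cube, (pd v (pd v u) p * pd e (pd e u) p - pd e (pd v u) p ^ 2) * φ p
      = -(1 / 2 * ∫ p in cube, pd v u p ^ 2 * pd e (pd e φ) p) := by
  have u1 : ∀ w, ContDiff ℝ 1 (pd w u) := fun w => hu.pd (by norm_num) w
  have φ1 : ContDiff ℝ 1 φ := hφ.of_le (by norm_num)
  have φe : ContDiff ℝ 1 (pd e φ) := hφ.pd (by norm_num) e
  have hve : ∀ p, pd v (pd e φ) p = 0 := by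
    intro p
    rw [pd_comm hφ]
    have : pd v φ = fun _ => 0 := funext hv
    simp [this, pd]
  have h1 := integral_pd_mul_pd_comm (u1 v) ((u1 e).mul φ1) (pu.pd v) ((pu.pd e).mul pφ) v e
  simp only [pd_mul (u1 e) φ1, hv, mul_zero, add_zero, pd_comm hu v e] at h1
  have h2 := integral_pd_pd_mul_pd_mul hu pu φe (pφ.pd e) hve e
  have c1 : ∀ w z, Continuous (pd w (pd z u)) := fun w z =>
    ((u1 z).pd (m := 0) (by norm_num) w).continuous
  have c2 : ∀ w, Continuous (pd w u) := fun w => (u1 w).continuous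
  have c3 := φ1.continuous
  have c4 := φe.continuous
  have c5 := c1 v v
  have c6 := c1 e e
  have c7 := c1 e v
  have c8 := c2 e
  have e1 : ∀ p, (pd v (pd v u) p * pd e (pd e u) p - pd e (pd v u) p ^ 2) * φ p
      = (pd v (pd v u) p * (pd e (pd e u) p * φ p + pd e u p * pd e φ p)
        - pd e (pd v u) p * (pd e (pd v u) p * φ p))
        - pd v (pd v u) p * (pd e u p * pd e φ p) := fun p => by ring
  simp only [e1]
  rw [integral_sub (integrableOn_cube (by fun_prop)) (integrableOn_cube (by fun_prop)),
    integral_sub (integrableOn_cube (by fun_prop)) (integrableOn_cube (by fun_prop)), h1, h2]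
  ring

/-- Averaging the equation against test functions independent of `x` linearizes it. -/
lemma CYeq.integral_exp_sub_one_mul {F u φ : R3 → ℝ} (h : CYeq F u)
    (hu : ContDiff ℝ 2 u) (pu : Periodic3 u)
    (hφ : ContDiff ℝ 2 φ) (pφ : Periodic3 φ) (hx : ∀ p, pd vx φ p = 0) :
    ∫ p in cube, (Real.exp (F p) - 1) * φ p
      = ∫ p in cube, (u p - 1 / 2 * pd vx u p ^ 2)
          * (pd vy (pd vy φ) p + pd vt (pd vt φ) p - pd vt φ p) := by
  have u0 : ContDiff ℝ 1 u := hu.of_le (by norm_num)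
  have φ0 : ContDiff ℝ 1 φ := hφ.of_le (by norm_num)
  have u1 : ∀ w, ContDiff ℝ 1 (pd w u) := fun w => hu.pd (by norm_num) w
  have φ1 : ∀ w, ContDiff ℝ 1 (pd w φ) := fun w => hφ.pd (by norm_num) w
  have c1 : ∀ w z, Continuous (pd w (pd z u)) := fun w z =>
    ((u1 z).pd (m := 0) (by norm_num) w).continuous
  have c2 : ∀ w z, Continuous (pd w (pd z φ)) := fun w z =>
    ((φ1 z).pd (m := 0) (by norm_num) w).continuous
  have a1 := c1 vx vx
  have a2 := c1 vy vy
  have a3 := c1 vt vt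
  have a4 := c1 vy vx
  have a5 := c1 vt vx
  have a6 := (u1 vx).continuous
  have a7 := (u1 vt).continuous
  have a8 := u0.continuous
  have b1 := c2 vy vy
  have b2 := c2 vt vt
  have b3 := (φ1 vt).continuous
  have b4 := φ0.continuous
  have i1 : ∫ p in cube, φ p * pd vx (pd vx u) p = 0 := by
    rw [integral_mul_pd φ0 (u1 vx) pφ (pu.pd vx)]
    simp [hx]
  have i2 := integral_mul_pd_pd hφ hu pφ pu vy
  have i3 := integral_mul_pd_pd hφ hu pφ pu vt
  have i4 := integral_mul_pd φ0 u0 pφ pu vt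
  have i5 := integral_hessian_minor_mul hu pu hφ pφ hx vy
  have i6 := integral_hessian_minor_mul hu pu hφ pφ hx vt
  have i7 := integral_pd_pd_mul_pd_mul hu pu φ0 pφ hx vt
  have hl : ∀ p, (Real.exp (F p) - 1) * φ p =
      φ p * pd vx (pd vx u) p + φ p * pd vy (pd vy u) p + φ p * pd vt (pd vt u) p
        + φ p * pd vt u p
        + (pd vx (pd vx u) p * pd vy (pd vy u) p - pd vy (pd vx u) p ^ 2) * φ p
        + (pd vx (pd vx u) p * pd vt (pd vt u) p - pd vt (pd vx u) p ^ 2) * φ p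
        + pd vx (pd vx u) p * (pd vt u p * φ p) := fun p => by
    rw [← h p]; ring
  have hr : ∀ p, (u p - 1 / 2 * pd vx u p ^ 2)
          * (pd vy (pd vy φ) p + pd vt (pd vt φ) p - pd vt φ p)
      = u p * pd vy (pd vy φ) p + u p * pd vt (pd vt φ) p - pd vt φ p * u p
        - 1 / 2 * (pd vx u p ^ 2 * pd vy (pd vy φ) p)
        - 1 / 2 * (pd vx u p ^ 2 * pd vt (pd vt φ) p)
        + 1 / 2 * (pd vx u p ^ 2 * pd vt φ p) := fun p => by ring
  simp only [hl, hr]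
  iterate 6
    rw [integral_add (integrableOn_cube (by fun_prop)) (integrableOn_cube (by fun_prop))]
  rw [i1, i2, i3, i4, i5, i6, i7]
  rw [integral_add (integrableOn_cube (by fun_prop)) (integrableOn_cube (by fun_prop)),
    integral_sub (integrableOn_cube (by fun_prop)) (integrableOn_cube (by fun_prop)),
    integral_sub (integrableOn_cube (by fun_prop)) (integrableOn_cube (by fun_prop)),
    integral_sub (integrableOn_cube (by fun_prop)) (integrableOn_cube (by fun_prop)),
    integral_add (integrableOn_cube (by fun_prop)) (integrableOn_cube (by fun_prop))]
  simp only [integral_const_mul]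
  ring

/-- The phase `2π (k₀ y + k₁ t)` as a linear functional on `ℝ³`. -/
def phase (k : Fin 2 → ℤ) : R3 →L[ℝ] ℝ :=
  (2 * Real.pi * k 0) • ((ContinuousLinearMap.fst ℝ ℝ ℝ).comp (ContinuousLinearMap.snd ℝ ℝ (ℝ × ℝ)))
    + (2 * Real.pi * k 1) •
      ((ContinuousLinearMap.snd ℝ ℝ ℝ).comp (ContinuousLinearMap.snd ℝ ℝ (ℝ × ℝ)))

lemma phase_apply (k : Fin 2 → ℤ) (p : R3) :
    phase k p = 2 * Real.pi * k 0 * p.2.1 + 2 * Real.pi * k 1 * p.2.2 := by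
  simp [phase]

lemma phase_vx (k : Fin 2 → ℤ) : phase k vx = 0 := by simp [phase_apply, vx]
lemma phase_vy (k : Fin 2 → ℤ) : phase k vy = k 0 * (2 * Real.pi) := by
  simp [phase_apply, vy]; ring
lemma phase_vt (k : Fin 2 → ℤ) : phase k vt = k 1 * (2 * Real.pi) := by
  simp [phase_apply, vt]; ring

lemma periodic3_cos_phase (k : Fin 2 → ℤ) : Periodic3 (fun p => Real.cos (phase k p)) := by
  intro p
  simp only [map_add, phase_vx, phase_vy, phase_vt, add_zero, Real.cos_add_int_mul_two_pi,
    and_self]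

lemma periodic3_sin_phase (k : Fin 2 → ℤ) : Periodic3 (fun p => Real.sin (phase k p)) := by
  intro p
  simp only [map_add, phase_vx, phase_vy, phase_vt, add_zero, Real.sin_add_int_mul_two_pi,
    and_self]

lemma pd_const_mul_cos (c : ℝ) (l : R3 →L[ℝ] ℝ) (e : R3) :
    pd e (fun p => c * Real.cos (l p)) = fun p => (-(c * l e)) * Real.sin (l p) := by
  funext p
  have h := (l.hasFDerivAt (x := p)).cos.const_mul c
  simp only [pd, h.fderiv]
  simp
  ring

lemma pd_const_mul_sin (c : ℝ) (l : R3 →L[ℝ] ℝ) (e : R3) :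
    pd e (fun p => c * Real.sin (l p)) = fun p => (c * l e) * Real.cos (l p) := by
  funext p
  have h := (l.hasFDerivAt (x := p)).sin.const_mul c
  simp only [pd, h.fderiv]
  simp
  ring

lemma pd_cos (l : R3 →L[ℝ] ℝ) (e : R3) :
    pd e (fun p => Real.cos (l p)) = fun p => (-(l e)) * Real.sin (l p) := by
  simpa using pd_const_mul_cos 1 l e

lemma pd_sin (l : R3 →L[ℝ] ℝ) (e : R3) :
    pd e (fun p => Real.sin (l p)) = fun p => l e * Real.cos (l p) := by
  simpa using pd_const_mul_sin 1 l e

/-- The `(y, t)`-Fourier coefficient of a function on the 3-torus. -/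
def sliceCoeff (g : R3 → ℝ) (k : Fin 2 → ℤ) : ℂ :=
  ⟨∫ p in cube, g p * Real.cos (phase k p), -∫ p in cube, g p * Real.sin (phase k p)⟩

lemma CYeq.norm_sliceCoeff_le {F u : R3 → ℝ} (h : CYeq F u)
    (hu : ContDiff ℝ 2 u) (pu : Periodic3 u) (k : Fin 2 → ℤ) :
    ‖sliceCoeff (fun p => u p - 1 / 2 * pd vx u p ^ 2) k‖ * ‖k‖ ^ 2
      ≤ ‖sliceCoeff (fun p => Real.exp (F p) - 1) k‖ := by
  have u1 : Continuous (pd vx u) := (hu.pd (m := 1) (by norm_num) vx).continuous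
  have u0 := hu.continuous
  have hc := h.integral_exp_sub_one_mul hu pu (φ := fun p => Real.cos (phase k p))
    (by fun_prop) (periodic3_cos_phase k) (by simp [pd_cos, phase_vx])
  have hs := h.integral_exp_sub_one_mul hu pu (φ := fun p => Real.sin (phase k p))
    (by fun_prop) (periodic3_sin_phase k) (by simp [pd_sin, phase_vx])
  set w : R3 → ℝ := fun p => u p - 1 / 2 * pd vx u p ^ 2 with hw
  have w0 : Continuous w := by fun_prop
  simp only [pd_cos, pd_sin, pd_const_mul_cos, pd_const_mul_sin, phase_vy, phase_vt] at hc hs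
  set a : ℝ := (k 0 * (2 * Real.pi)) ^ 2 + (k 1 * (2 * Real.pi)) ^ 2 with ha
  set b : ℝ := k 1 * (2 * Real.pi) with hb
  set C : ℝ := ∫ p in cube, w p * Real.cos (phase k p) with hC
  set S : ℝ := ∫ p in cube, w p * Real.sin (phase k p) with hS
  have hc' : ∫ p in cube, (Real.exp (F p) - 1) * Real.cos (phase k p) = -a * C + b * S := by
    rw [hc, hC, hS, ← integral_const_mul, ← integral_const_mul,
      ← integral_add (integrableOn_cube (by fun_prop)) (integrableOn_cube (by fun_prop))]
    congr 1
    funext p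
    simp only [hw, ha]
    ring
  have hs' : ∫ p in cube, (Real.exp (F p) - 1) * Real.sin (phase k p) = -a * S - b * C := by
    rw [hs, hC, hS, ← integral_const_mul, ← integral_const_mul,
      ← integral_sub (integrableOn_cube (by fun_prop)) (integrableOn_cube (by fun_prop))]
    congr 1
    funext p
    simp only [hw, ha]
    ring
  have hk : ‖k‖ ^ 2 ≤ a := by
    have hpi : (1 : ℝ) ≤ (2 * Real.pi) ^ 2 := by nlinarith [Real.pi_gt_three]
    have hle : ‖k‖ ≤ Real.sqrt ((k 0 : ℝ) ^ 2 + (k 1 : ℝ) ^ 2) := by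
      refine (pi_norm_le_iff_of_nonneg (Real.sqrt_nonneg _)).2 fun i => ?_
      refine Real.le_sqrt_of_sq_le ?_
      rw [Int.norm_eq_abs, sq_abs]
      fin_cases i
      · simp; positivity
      · simp; positivity
    have hsq : ‖k‖ ^ 2 ≤ (k 0 : ℝ) ^ 2 + (k 1 : ℝ) ^ 2 := by
      rw [← Real.sq_sqrt (by positivity : (0 : ℝ) ≤ (k 0 : ℝ) ^ 2 + (k 1 : ℝ) ^ 2)]
      gcongr
    rw [ha]
    nlinarith [sq_nonneg (k 0 : ℝ), sq_nonneg (k 1 : ℝ)]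
  have hmul : sliceCoeff (fun p => Real.exp (F p) - 1) k = ⟨-a, b⟩ * sliceCoeff w k := by
    apply Complex.ext
    · simp only [sliceCoeff, Complex.mul_re, hc', ← hC, ← hS]; ring
    · simp only [sliceCoeff, Complex.mul_im, hs', ← hC, ← hS]; ring
  rw [hmul, norm_mul, mul_comm]
  gcongr
  refine hk.trans ?_
  have := Complex.abs_re_le_norm ⟨-a, b⟩
  simp only [abs_neg] at this
  exact (le_abs_self a).trans this

lemma Periodic3.add_int {g : R3 → ℝ} (pg : Periodic3 g) (x y t : ℝ) (m n : ℤ) :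
    g (x, y + m, t + n) = g (x, y, t) := by
  have h1 : Function.Periodic (fun y => g (x, y, t + n)) 1 := fun y => pg.add_vy x y _
  have h2 : Function.Periodic (fun t => g (x, y, t)) 1 := fun t => pg.add_vt x y t
  have h3 := h1.int_mul m y
  have h4 := h2.int_mul n t
  simp only [mul_one] at h3 h4
  rw [h3, h4]

lemma mFourier_neg_coe (k : Fin 2 → ℤ) (q : Fin 2 → ℝ) (x : ℝ) :
    UnitAddTorus.mFourier (-k) (fun i => (q i : UnitAddCircle))
      = Real.cos (phase k (x, q 0, q 1)) - Real.sin (phase k (x, q 0, q 1)) * Complex.I := by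
  rw [UnitAddTorus.mFourier_neg]
  simp only [UnitAddTorus.mFourier, ContinuousMap.coe_mk, Fin.prod_univ_two, fourier_coe_apply,
    ← Complex.exp_add]
  have : 2 * Real.pi * Complex.I * k 0 * q 0 / (1 : ℝ) + 2 * Real.pi * Complex.I * k 1 * q 1 / (1 : ℝ)
      = ((phase k (x, q 0, q 1) : ℝ) : ℂ) * Complex.I := by
    rw [phase_apply]; push_cast; ring
  rw [this, Complex.exp_mul_I]
  simp only [← Complex.ofReal_cos, ← Complex.ofReal_sin, map_add, map_mul, Complex.conj_ofReal,
    Complex.conj_I]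
  ring

/-- Averaging a periodic function over `x` produces a continuous function on the 2-torus. -/
lemma exists_fiber_integral_lift {g : R3 → ℝ} (hg : Continuous g) (pg : Periodic3 g) :
    ∃ G : C(UnitAddTorus (Fin 2), ℂ),
      (∀ q : Fin 2 → ℝ, G (fun i => (q i : UnitAddCircle))
        = ((∫ x in (0 : ℝ)..1, g (x, q 0, q 1) : ℝ) : ℂ)) ∧
      ∀ k, UnitAddTorus.mFourierCoeff G k = sliceCoeff g k := by
  have hq : IsOpenQuotientMap
      (Pi.map fun (_ : Fin 2) (r : ℝ) => (r : UnitAddCircle)) :=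
    IsOpenQuotientMap.piMap fun _ => QuotientAddGroup.isOpenQuotientMap_mk
  have hc : Continuous fun q : Fin 2 → ℝ => ∫ x in (0 : ℝ)..1, g (x, q 0, q 1) :=
    intervalIntegral.continuous_parametric_intervalIntegral_of_continuous' (by fun_prop) _ _
  let w : C(Fin 2 → ℝ, ℂ) :=
    ⟨fun q => ((∫ x in (0 : ℝ)..1, g (x, q 0, q 1) : ℝ) : ℂ), by fun_prop⟩
  let π : C(Fin 2 → ℝ, UnitAddTorus (Fin 2)) := ⟨_, hq.continuous⟩
  have hfac : Function.FactorsThrough w π := by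
    intro a b hab
    have h : ∀ i, ∃ n : ℤ, a i = b i + n := by
      intro i
      have hi : ((a i : ℝ) : UnitAddCircle) = (b i : ℝ) := congrFun hab i
      rw [eq_comm, QuotientAddGroup.eq, AddSubgroup.mem_zmultiples_iff] at hi
      obtain ⟨n, hn⟩ := hi
      refine ⟨n, ?_⟩
      simp only [zsmul_eq_mul, mul_one] at hn
      linarith
    obtain ⟨m, hm⟩ := h 0
    obtain ⟨n, hn⟩ := h 1
    simp only [w, ContinuousMap.coe_mk, hm, hn, pg.add_int]
  let G : C(UnitAddTorus (Fin 2), ℂ) :=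
    Topology.IsQuotientMap.lift (f := π) hq.isQuotientMap w hfac
  have hG : ∀ q : Fin 2 → ℝ, G (fun i => (q i : UnitAddCircle))
        = ((∫ x in (0 : ℝ)..1, g (x, q 0, q 1) : ℝ) : ℂ) := fun q =>
    DFunLike.congr_fun (Topology.IsQuotientMap.lift_comp (f := π) hq.isQuotientMap w hfac) q
  refine ⟨G, hG, fun k => ?_⟩
  rw [UnitAddTorus.mFourierCoeff_eq_integral G k 0]
  have hset : {q : Fin 2 → ℝ | ∀ i, q i ∈ Ioc ((0 : Fin 2 → ℝ) i) ((0 : Fin 2 → ℝ) i + 1)}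
      = MeasurableEquiv.finTwoArrow ⁻¹' (Ioc (0 : ℝ) 1 ×ˢ Ioc (0 : ℝ) 1) := by
    ext q
    simp [Fin.forall_fin_two]
  have hint : ∀ q : Fin 2 → ℝ,
      UnitAddTorus.mFourier (-k) (fun i => (q i : UnitAddCircle)) • G (fun i => (q i : UnitAddCircle))
      = (fun z : ℝ × ℝ =>
        ((∫ x in (0 : ℝ)..1, g (x, z) * Real.cos (phase k (x, z)) : ℝ) : ℂ)
        - ((∫ x in (0 : ℝ)..1, g (x, z) * Real.sin (phase k (x, z)) : ℝ) : ℂ) * Complex.I)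
          (MeasurableEquiv.finTwoArrow q) := by
    intro q
    have hph : ∀ x : ℝ, phase k (x, q 0, q 1) = phase k (0, q 0, q 1) := fun x => by
      simp [phase_apply]
    rw [hG, mFourier_neg_coe k q 0]
    simp only [MeasurableEquiv.finTwoArrow_apply, hph, intervalIntegral.integral_mul_const,
      smul_eq_mul]
    push_cast
    ring
  simp_rw [hint]
  rw [hset]
  refine ((volume_preserving_finTwoArrow ℝ).setIntegral_preimage_emb
    (MeasurableEquiv.measurableEmbedding _) (fun z : ℝ × ℝ =>
        ((∫ x in (0 : ℝ)..1, g (x, z) * Real.cos (phase k (x, z)) : ℝ) : ℂ)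
        - ((∫ x in (0 : ℝ)..1, g (x, z) * Real.sin (phase k (x, z)) : ℝ) : ℂ) * Complex.I)
    _).trans ?_
  have hgc : Continuous fun p => g p * Real.cos (phase k p) := by fun_prop
  have hgs : Continuous fun p => g p * Real.sin (phase k p) := by fun_prop
  have hi : ∀ f : R3 → ℝ, Continuous f →
      IntegrableOn (fun z : ℝ × ℝ => ((∫ x in (0 : ℝ)..1, f (x, z) : ℝ) : ℂ))
        (Ioc (0 : ℝ) 1 ×ˢ Ioc (0 : ℝ) 1) := by
    intro f hf
    have hc : Continuous fun z : ℝ × ℝ => ∫ x in (0 : ℝ)..1, f (x, z) :=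
      intervalIntegral.continuous_parametric_intervalIntegral_of_continuous' (by fun_prop) _ _
    exact ((Complex.continuous_ofReal.comp hc).continuousOn.integrableOn_compact
      (isCompact_Icc.prod isCompact_Icc)).mono_set
      (prod_mono Ioc_subset_Icc_self Ioc_subset_Icc_self)
  rw [integral_sub (hi _ hgc) ((hi _ hgs).mul_const _), integral_mul_const, integral_complex_ofReal,
    integral_complex_ofReal, ← integral_cube_eq_fiber hgc, ← integral_cube_eq_fiber hgs]
  apply Complex.ext <;> simp [sliceCoeff]

section FourierBound

/-- The normalization of the measure on the circle used for `UnitAddTorus.mFourierCoeff`. -/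
local instance : MeasureSpace UnitAddCircle := ⟨AddCircle.haarAddCircle⟩

local instance : IsProbabilityMeasure (volume : Measure UnitAddCircle) :=
  inferInstanceAs (IsProbabilityMeasure AddCircle.haarAddCircle)

/-- A continuous function on the 2-torus is bounded in terms of its mean and of the sup norm of
a function whose Fourier coefficients dominate those of its Laplacian. -/
lemma norm_le_of_mFourierCoeff_le {G H : C(UnitAddTorus (Fin 2), ℂ)} {c M : ℝ}
    (h0 : ‖UnitAddTorus.mFourierCoeff G 0‖ ≤ c) (hM : ∀ z, ‖H z‖ ≤ M)
    (hGH : ∀ k, ‖UnitAddTorus.mFourierCoeff G k‖ * ‖k‖ ^ 2 ≤ ‖UnitAddTorus.mFourierCoeff H k‖)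
    (z : UnitAddTorus (Fin 2)) :
    ‖G z‖ ≤ c + M ^ 2 + ∑' k : Fin 2 → ℤ, ‖k‖ ^ (-4 : ℝ) := by
  have hM0 : 0 ≤ M := (norm_nonneg _).trans (hM z)
  have hS : Summable fun k : Fin 2 → ℤ => ‖k‖ ^ (-4 : ℝ) :=
    EisensteinSeries.summable_one_div_norm_rpow (by norm_num)
  have hP := UnitAddTorus.hasSum_sq_mFourierCoeff (ContinuousMap.toLp 2 volume ℂ H)
  simp only [UnitAddTorus.mFourierCoeff_toLp] at hP
  have hI : ∫ t, ‖ContinuousMap.toLp (E := ℂ) 2 volume ℂ H t‖ ^ 2 ≤ M ^ 2 := by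
    have h1 : ∀ᵐ t ∂(volume : Measure (UnitAddTorus (Fin 2))),
        ‖(‖ContinuousMap.toLp (E := ℂ) 2 volume ℂ H t‖ ^ 2 : ℝ)‖ ≤ M ^ 2 := by
      filter_upwards [ContinuousMap.coeFn_toLp (𝕜 := ℂ) (p := 2) volume H] with t ht
      rw [ht, norm_pow, norm_norm]
      exact pow_le_pow_left₀ (norm_nonneg _) (hM t) 2
    have h2 := norm_integral_le_of_norm_le_const h1
    rw [probReal_univ, mul_one] at h2
    exact (le_abs_self _).trans h2
  have hδ : HasSum (fun k : Fin 2 → ℤ => if k = 0 then c else 0) c := hasSum_ite_eq 0 c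
  have hB := (hδ.add hP).add hS.hasSum
  have hle : ∀ k, ‖UnitAddTorus.mFourierCoeff G k‖
      ≤ ((if k = 0 then c else 0) + ‖UnitAddTorus.mFourierCoeff H k‖ ^ 2) + ‖k‖ ^ (-4 : ℝ) := by
    intro k
    by_cases hk : k = 0
    · subst hk
      simp only [if_true]
      have : (0 : ℝ) ≤ ‖(0 : Fin 2 → ℤ)‖ ^ (-4 : ℝ) := by positivity
      nlinarith [sq_nonneg ‖UnitAddTorus.mFourierCoeff H 0‖]
    · have hkp : 0 < ‖k‖ := norm_pos_iff.2 hk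
      simp only [hk, if_false, zero_add]
      have e1 : ‖k‖ ^ (-4 : ℝ) = ((‖k‖ ^ 2)⁻¹) ^ 2 := by
        rw [Real.rpow_neg hkp.le, inv_pow, ← pow_mul]
        norm_cast
      have e2 : ‖UnitAddTorus.mFourierCoeff G k‖
          ≤ ‖UnitAddTorus.mFourierCoeff H k‖ * (‖k‖ ^ 2)⁻¹ := by
        rw [← div_eq_mul_inv, le_div_iff₀ (by positivity)]
        exact hGH k
      rw [e1]
      nlinarith [sq_nonneg (‖UnitAddTorus.mFourierCoeff H k‖ - (‖k‖ ^ 2)⁻¹),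
        sq_nonneg ‖UnitAddTorus.mFourierCoeff H k‖, sq_nonneg ((‖k‖ ^ 2)⁻¹)]
  have hsum : Summable (UnitAddTorus.mFourierCoeff G) :=
    Summable.of_norm_bounded hB.summable hle
  have hz := UnitAddTorus.hasSum_mFourier_series_apply_of_summable hsum z
  have hterm : ∀ k, ‖UnitAddTorus.mFourierCoeff G k • UnitAddTorus.mFourier k z‖
      ≤ ((if k = 0 then c else 0) + ‖UnitAddTorus.mFourierCoeff H k‖ ^ 2) + ‖k‖ ^ (-4 : ℝ) := by
    intro k
    refine le_trans ?_ (hle k)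
    rw [norm_smul]
    have : ‖UnitAddTorus.mFourier k z‖ ≤ 1 := by
      simpa only [UnitAddTorus.mFourier_norm] using (UnitAddTorus.mFourier k).norm_coe_le_norm z
    exact mul_le_of_le_one_right (norm_nonneg _) this
  rw [← hz.tsum_eq]
  refine (tsum_of_norm_bounded hB hterm).trans ?_
  gcongr

end FourierBound

section LineEstimates

variable {u : R3 → ℝ}

lemma hasDerivAt_line {f : R3 → ℝ} (hf : ContDiff ℝ 1 f) (x y t : ℝ) :
    HasDerivAt (fun s : ℝ => f (s, y, t)) (pd vx f (x, y, t)) x := by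
  simpa [vx] using hasDerivAt_comp_add_smul hf (0, y, t) vx x

lemma exists_pd_vx_eq_zero {f : R3 → ℝ} (hf : ContDiff ℝ 1 f) (pf : Periodic3 f) (x y t : ℝ) :
    ∃ c ∈ Ioo x (x + 1), pd vx f (c, y, t) = 0 :=
  exists_hasDerivAt_eq_zero (f := fun s => f (s, y, t)) (lt_add_one x)
    (hf.continuous.comp (by fun_prop)).continuousOn (pf.add_vx x y t).symm
    fun s _ => hasDerivAt_line hf s y t

lemma CYeq.pd_vx_pd_vx_add_one_pos {F : R3 → ℝ} (h : CYeq F u) (hu : ContDiff ℝ 2 u)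
    (pu : Periodic3 u) (x y t : ℝ) : 0 < pd vx (pd vx u) (x, y, t) + 1 := by
  have hux : ContDiff ℝ 1 (pd vx u) := hu.pd (by norm_num) vx
  have hc : Continuous fun s : ℝ => pd vx (pd vx u) (s, y, t) + 1 := by
    have := (hux.pd (m := 0) (by norm_num) vx).continuous
    fun_prop
  have hne : ∀ s, pd vx (pd vx u) (s, y, t) + 1 ≠ 0 := by
    intro s hs
    have := h (s, y, t)
    rw [hs] at this
    nlinarith [Real.exp_pos (F (s, y, t)), sq_nonneg (pd vy (pd vx u) (s, y, t)),
      sq_nonneg (pd vt (pd vx u) (s, y, t))]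
  obtain ⟨c, -, hc0⟩ := exists_pd_vx_eq_zero hux (pu.pd vx) x y t
  by_contra! hx
  obtain ⟨s, -, hs⟩ := intermediate_value_uIcc (a := x) (b := c) hc.continuousOn
    (show (0 : ℝ) ∈ _ from mem_uIcc_of_le hx (by simp [hc0]))
  exact hne s hs

lemma CYeq.abs_pd_vx_le_one {F : R3 → ℝ} (h : CYeq F u) (hu : ContDiff ℝ 2 u)
    (pu : Periodic3 u) (x y t : ℝ) : |pd vx u (x, y, t)| ≤ 1 := by
  have hux : ContDiff ℝ 1 (pd vx u) := hu.pd (by norm_num) vx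
  have hd : ∀ s, HasDerivAt (fun s => pd vx u (s, y, t) + s)
      (pd vx (pd vx u) (s, y, t) + 1) s :=
    fun s => (hasDerivAt_line hux s y t).add (hasDerivAt_id s)
  have hm : Monotone fun s => pd vx u (s, y, t) + s :=
    monotone_of_hasDerivAt_nonneg hd fun s => (h.pd_vx_pd_vx_add_one_pos hu pu s y t).le
  have hu1 : ContDiff ℝ 1 u := hu.of_le (by norm_num)
  obtain ⟨c, hc, hc0⟩ := exists_pd_vx_eq_zero hu1 pu x y t
  obtain ⟨d, hd, hd0⟩ := exists_pd_vx_eq_zero hu1 pu (x - 1) y t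
  have h1 := hm hc.1.le
  have h2 := hm (show d ≤ x by linarith [hd.2])
  simp only [hc0, hd0] at h1 h2
  rw [abs_le]
  constructor <;> linarith [hc.2, hd.1]

end LineEstimates

lemma CYeq.abs_sub_fiber_integral_le {F u : R3 → ℝ} (h : CYeq F u) (hu : ContDiff ℝ 2 u)
    (pu : Periodic3 u) (x y t : ℝ) :
    |u (x, y, t) - ∫ s in (0 : ℝ)..1, (u (s, y, t) - 1 / 2 * pd vx u (s, y, t) ^ 2)| ≤ 3 / 2 := by
  have hu1 : ContDiff ℝ 1 u := hu.of_le (by norm_num)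
  have c0 : Continuous u := hu.continuous
  have c1 : Continuous (pd vx u) := (hu.pd (m := 1) (by norm_num) vx).continuous
  have hper : Function.Periodic
      (fun s => u (s, y, t) - 1 / 2 * pd vx u (s, y, t) ^ 2) 1 := fun s => by
    simp only [pu.add_vx, (pu.pd vx).add_vx]
  have hshift := hper.intervalIntegral_add_eq 0 x
  rw [zero_add] at hshift
  have hsub : u (x, y, t) - ∫ s in x..x + 1, (u (s, y, t) - 1 / 2 * pd vx u (s, y, t) ^ 2)
      = ∫ s in x..x + 1, (u (x, y, t) - (u (s, y, t) - 1 / 2 * pd vx u (s, y, t) ^ 2)) := by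
    rw [intervalIntegral.integral_sub intervalIntegrable_const
      (Continuous.intervalIntegrable (by fun_prop) _ _), intervalIntegral.integral_const,
      add_sub_cancel_left, one_smul]
  rw [hshift, hsub, ← Real.norm_eq_abs]
  have key : ∀ s ∈ uIoc x (x + 1),
      ‖u (x, y, t) - (u (s, y, t) - 1 / 2 * pd vx u (s, y, t) ^ 2)‖ ≤ 3 / 2 := by
    intro s hs
    rw [uIoc_of_le (by linarith)] at hs
    have h1 := convex_univ.norm_image_sub_le_of_norm_hasDerivWithin_le
      (f := fun s => u (s, y, t)) (fun s _ => (hasDerivAt_line hu1 s y t).hasDerivWithinAt)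
      (fun s _ => h.abs_pd_vx_le_one hu pu s y t) (mem_univ s) (mem_univ x)
    simp only [Real.norm_eq_abs, one_mul] at h1
    have h2 : |x - s| ≤ 1 := by rw [abs_le]; constructor <;> linarith [hs.1, hs.2]
    have h3 := abs_le.1 (h1.trans h2)
    have h4 : pd vx u (s, y, t) ^ 2 ≤ 1 :=
      (sq_le_one_iff_abs_le_one _).2 (h.abs_pd_vx_le_one hu pu s y t)
    rw [Real.norm_eq_abs, abs_le]
    constructor <;> nlinarith [h3.1, h3.2, sq_nonneg (pd vx u (s, y, t))]
  simpa using intervalIntegral.norm_integral_le_of_norm_le_const key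

lemma volume_real_cube : volume.real cube = 1 := by
  rw [cube_eq_prod, Measure.volume_eq_prod, measureReal_prod_prod, Measure.volume_eq_prod,
    measureReal_prod_prod]
  simp

lemma CYeq.norm_sliceCoeff_zero_le {F u : R3 → ℝ} (h : CYeq F u) (hu : ContDiff ℝ 2 u)
    (pu : Periodic3 u) (hm : ZeroMean u) :
    ‖sliceCoeff (fun p => u p - 1 / 2 * pd vx u p ^ 2) 0‖ ≤ 1 / 2 := by
  have c0 : Continuous u := hu.continuous
  have c1 : Continuous (pd vx u) := (hu.pd (m := 1) (by norm_num) vx).continuous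
  have hph : ∀ p, phase 0 p = 0 := fun p => by simp [phase_apply]
  have hval : sliceCoeff (fun p => u p - 1 / 2 * pd vx u p ^ 2) 0
      = ((-(1 / 2 * ∫ p in cube, pd vx u p ^ 2) : ℝ) : ℂ) := by
    have hm' : ∫ p in cube, u p = 0 := hm
    apply Complex.ext
    · simp only [sliceCoeff, hph, Real.cos_zero, mul_one, Complex.ofReal_re]
      rw [integral_sub (integrableOn_cube c0) (integrableOn_cube (by fun_prop)), hm',
        integral_const_mul, zero_sub]
    · simp [sliceCoeff, hph]
  have hb : ‖∫ p in cube, pd vx u p ^ 2‖ ≤ 1 * volume.real cube := by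
    refine norm_setIntegral_le_of_norm_le_const isCompact_cube.measure_lt_top fun p _ => ?_
    rw [norm_pow]
    exact pow_le_one₀ (norm_nonneg _) (h.abs_pd_vx_le_one hu pu p.1 p.2.1 p.2.2)
  rw [volume_real_cube] at hb
  rw [hval, Complex.norm_real, norm_neg, norm_mul]
  norm_num at hb ⊢
  linarith

end Lemmas

/-- A priori `C⁰` estimate: for every `K > 0` there is `C₀ > 0`,
depending only on `K`, bounding `sup |u|` for every solution `u` of the reduced
Calabi–Yau equation whose datum `F` is `C²`, `1`-periodic, normalized, and
satisfies `sup |F| ≤ K`. -/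
theorem stmt9 (K : ℝ) (hK : 0 < K) :
    ∃ C₀ : ℝ, 0 < C₀ ∧
      ∀ F u : R3 → ℝ,
        ContDiff ℝ 2 F → Periodic3 F → (∀ p : R3, |F p| ≤ K) →
        (∫ p in cube, Real.exp (F p)) = 1 →
        ContDiff ℝ 2 u → Periodic3 u → ZeroMean u → CYeq F u →
        ∀ p : R3, |u p| ≤ C₀ := by
  refine ⟨1 / 2 + (Real.exp K + 1) ^ 2 + (∑' k : Fin 2 → ℤ, ‖k‖ ^ (-4 : ℝ)) + 3 / 2, ?_, ?_⟩
  · have : 0 ≤ ∑' k : Fin 2 → ℤ, ‖k‖ ^ (-4 : ℝ) := tsum_nonneg fun k => by positivity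
    positivity
  intro F u hF pF hFK _ hu pu hm h p
  obtain ⟨x, y, t⟩ := p
  have c0 : Continuous u := hu.continuous
  have c1 : Continuous (pd vx u) := (hu.pd (m := 1) (by norm_num) vx).continuous
  have cF : Continuous F := hF.continuous
  obtain ⟨G, hG, hGc⟩ := exists_fiber_integral_lift
    (g := fun p => u p - 1 / 2 * pd vx u p ^ 2) (by fun_prop)
    (fun p => by simp only [pu p, (pu.pd vx) p, and_self])
  obtain ⟨H, hH, hHc⟩ := exists_fiber_integral_lift
    (g := fun p => Real.exp (F p) - 1) (by fun_prop)
    (fun p => by simp only [pF p, and_self])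
  have hHM : ∀ z, ‖H z‖ ≤ Real.exp K + 1 := by
    intro z
    obtain ⟨q, rfl⟩ : ∃ q : Fin 2 → ℝ, (fun i => (q i : UnitAddCircle)) = z :=
      ⟨fun i => (z i).out, funext fun i => (z i).out_eq'⟩
    rw [hH, Complex.norm_real]
    have hb : ∀ s ∈ Set.uIoc (0 : ℝ) 1, ‖Real.exp (F (s, q 0, q 1)) - 1‖ ≤ Real.exp K + 1 := by
      intro s _
      have h1 := Real.exp_le_exp.2 (abs_le.1 (hFK (s, q 0, q 1))).2
      have h2 := Real.exp_pos (F (s, q 0, q 1))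
      rw [Real.norm_eq_abs, abs_le]
      constructor <;> linarith
    simpa using intervalIntegral.norm_integral_le_of_norm_le_const hb
  have hmain := norm_le_of_mFourierCoeff_le (c := 1 / 2)
    (by rw [hGc]; exact h.norm_sliceCoeff_zero_le hu pu hm) hHM
    (fun k => by rw [hGc, hHc]; exact h.norm_sliceCoeff_le hu pu k)
    (fun i => ((![y, t] i : ℝ) : UnitAddCircle))
  rw [hG, Complex.norm_real, Real.norm_eq_abs] at hmain
  simp only [Matrix.cons_val_zero, Matrix.cons_val_one] at hmain
  have hosc := h.abs_sub_fiber_integral_le hu pu x y t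
  have htri := abs_sub_abs_le_abs_sub (u (x, y, t))
    (∫ s in (0 : ℝ)..1, (u (s, y, t) - 1 / 2 * pd vx u (s, y, t) ^ 2))
  linarith

end
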